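/- Let E ⊂ R^d be compact with C^{1,1} boundary, 0 ∈ ∂E with outer normal e_d, with interior and exterior tangent balls of radius δ at 0. Then lim_{s→0+} (H^s(0, E) − d ω_d / s) = H^0(0, E), where H^s is the s-fractional curvature and H^0 is the 0-fractional curvature. -/

import Mathlib

open MeasureTheory Metric Filter Set

/-- Volume of the unit ball in `ℝ^d` (the constant `ω_d`). -/
noncomputable def unitBallVol (d : ℕ) : ℝ :=
  (volume (Metric.ball (0 : EuclideanSpace ℝ (Fin d)) 1)).toReal

/-- `χ_{ℝ^d ∖ E}(y) - χ_E(y)`. -/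
noncomputable def chiDiff {d : ℕ} (E : Set (EuclideanSpace ℝ (Fin d)))
    (y : EuclideanSpace ℝ (Fin d)) : ℝ :=
  Set.indicator Eᶜ (fun _ => (1:ℝ)) y - Set.indicator E (fun _ => (1:ℝ)) y

/-- The unit vector `e_d` (last coordinate direction) in `ℝ^d`. -/
noncomputable def ed (d : ℕ) : EuclideanSpace ℝ (Fin d) :=
  if h : 0 < d then EuclideanSpace.single (⟨d - 1, by omega⟩ : Fin d) 1 else 0

/-- `H` is the value of the `s`-fractional curvature of `E` at `x`, defined as the
principal value `lim_{r→0⁺} ∫_{ℝ^d ∖ B_r(x)} (χ_{Eᶜ}(y) - χ_E(y))/|x-y|^{d+s} dy`. -/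
def HasFracCurv {d : ℕ} (s : ℝ) (E : Set (EuclideanSpace ℝ (Fin d)))
    (x : EuclideanSpace ℝ (Fin d)) (H : ℝ) : Prop :=
  Tendsto (fun r : ℝ => ∫ y in (Metric.ball x r)ᶜ, chiDiff E y / ‖y - x‖ ^ ((d:ℝ) + s))
    (nhdsWithin 0 (Set.Ioi 0)) (nhds H)

/-- Uniform two-sided (interior and exterior) tangent ball condition: the standard
geometric characterization of a set with compact boundary of class `C^{1,1}`. -/
def TwoSidedBallCond {d : ℕ} (E : Set (EuclideanSpace ℝ (Fin d))) : Prop :=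
  ∃ δ > 0, ∀ x ∈ frontier E, ∃ ν : EuclideanSpace ℝ (Fin d), ‖ν‖ = 1 ∧
    Metric.ball (x - δ • ν) δ ⊆ E ∧ Metric.ball (x + δ • ν) δ ⊆ Eᶜ

/-- The `0`-fractional curvature `H^0(x,E)`, defined with the cutoff radius
`R = diam E + 1 > diam E` (the value is independent of the choice of `R > diam E`). -/
noncomputable def H0 {d : ℕ} (E : Set (EuclideanSpace ℝ (Fin d)))
    (x : EuclideanSpace ℝ (Fin d)) : ℝ :=
  limUnder (nhdsWithin (0:ℝ) (Set.Ioi 0))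
    (fun r => ∫ y in Metric.ball x (Metric.diam E + 1) \ Metric.ball x r,
      chiDiff E y / ‖y - x‖ ^ (d:ℝ))
  - d * unitBallVol d * Real.log (Metric.diam E + 1)

/-- The `s`-Riesz curvature `K^s(x,E) = -2 ∫_E |x-y|^{-(d+s)} dy` of a compact set. -/
noncomputable def Ks {d : ℕ} (s : ℝ) (E : Set (EuclideanSpace ℝ (Fin d)))
    (x : EuclideanSpace ℝ (Fin d)) : ℝ :=
  -2 * ∫ y in E, 1 / ‖x - y‖ ^ ((d:ℝ) + s)

/-- Outer Minkowski curvature `κ_r^{ou}(x,E)` relative to a normal (vector) field `ν`. -/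
noncomputable def kappaOut {d : ℕ} (E : Set (EuclideanSpace ℝ (Fin d)))
    (ν : EuclideanSpace ℝ (Fin d) → EuclideanSpace ℝ (Fin d)) (r : ℝ)
    (x : EuclideanSpace ℝ (Fin d)) : ℝ :=
  if Metric.infDist (x + r • ν x) E = r then
    (1 / (2 * r)) * LinearMap.det
      ((ContinuousLinearMap.id ℝ (EuclideanSpace ℝ (Fin d)) + r • fderiv ℝ ν x).toLinearMap)
  else 0

/-- Inner Minkowski curvature `κ_r^{in}(x,E)` relative to a normal (vector) field `ν`. -/
noncomputable def kappaIn {d : ℕ} (E : Set (EuclideanSpace ℝ (Fin d)))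
    (ν : EuclideanSpace ℝ (Fin d) → EuclideanSpace ℝ (Fin d)) (r : ℝ)
    (x : EuclideanSpace ℝ (Fin d)) : ℝ :=
  if Metric.infDist (x - r • ν x) Eᶜ = r then
    -(1 / (2 * r)) * LinearMap.det
      ((ContinuousLinearMap.id ℝ (EuclideanSpace ℝ (Fin d)) - r • fderiv ℝ ν x).toLinearMap)
  else 0

/-- Regularized Minkowski curvature `κ_r^f(x,E) = ∫_0^1 (-s f'(s)) κ_{rs}(x,E) ds`. -/
noncomputable def kappaF {d : ℕ} (f : ℝ → ℝ) (E : Set (EuclideanSpace ℝ (Fin d)))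
    (ν : EuclideanSpace ℝ (Fin d) → EuclideanSpace ℝ (Fin d)) (r : ℝ)
    (x : EuclideanSpace ℝ (Fin d)) : ℝ :=
  ∫ t in Set.Ioc (0:ℝ) 1, (-t * deriv f t) * (kappaOut E ν (r*t) x + kappaIn E ν (r*t) x)

lemma integrable_norm_rpow_neg_of_measure_ball_le {V : Type*} [NormedAddCommGroup V]
    [MeasurableSpace V] [BorelSpace V] (μ : Measure V) [IsFiniteMeasure μ] {C p q : ℝ}
    (hp : 0 < p) (hpq : p < q)
    (h : ∀ t : ℝ, 0 < t → μ (ball 0 t) ≤ ENNReal.ofReal (C * t ^ q)) :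
    Integrable (fun y => ‖y‖ ^ (-p)) μ := by
  have hm : Measurable (fun y : V => ‖y‖ ^ (-p)) := measurable_norm.pow_const _
  have hnn : ∀ y : V, 0 ≤ ‖y‖ ^ (-p) := fun y => Real.rpow_nonneg (norm_nonneg y) _
  refine ⟨hm.aestronglyMeasurable, ?_⟩
  rw [hasFiniteIntegral_iff_ofReal (ae_of_all _ hnn),
    lintegral_eq_lintegral_meas_lt μ (ae_of_all _ hnn) hm.aemeasurable,
    ← Ioc_union_Ioi_eq_Ioi zero_le_one]
  refine (lintegral_union_le _ _ _).trans_lt (ENNReal.add_lt_top.2 ⟨?_, ?_⟩)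
  · calc ∫⁻ t in Ioc (0 : ℝ) 1, μ {a | t < ‖a‖ ^ (-p)}
        ≤ ∫⁻ _ in Ioc (0 : ℝ) 1, μ univ := by gcongr; exact subset_univ _
      _ < ⊤ := by simp
  · have hq : -(q / p) < -1 := by
      rw [neg_lt_neg_iff, one_lt_div hp]; exact hpq
    calc ∫⁻ t in Ioi (1 : ℝ), μ {a | t < ‖a‖ ^ (-p)}
        ≤ ∫⁻ t in Ioi (1 : ℝ), ENNReal.ofReal (C * t ^ (-(q / p))) := by
          refine setLIntegral_mono' measurableSet_Ioi fun t ht => ?_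
          have ht0 : 0 < t := zero_lt_one.trans ht
          have hsub : {a : V | t < ‖a‖ ^ (-p)} ⊆ ball 0 (t ^ (-p⁻¹)) := by
            intro a ha
            rw [mem_ball_zero_iff]
            rcases (norm_nonneg a).eq_or_lt with h0 | h0
            · rw [← h0]; positivity
            · have := Real.rpow_lt_rpow_of_neg ht0 ha (z := -p⁻¹) (by simpa using hp)
              rwa [← Real.rpow_mul h0.le, neg_mul_neg, mul_inv_cancel₀ hp.ne',
                Real.rpow_one] at this
          refine (measure_mono hsub).trans ((h _ (by positivity)).trans_eq ?_)
          rw [← Real.rpow_mul ht0.le]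
          congr 3
          field_simp
      _ < ⊤ := by
          have := (integrableOn_Ioi_rpow_of_lt hq zero_lt_one).const_mul C
          exact this.lintegral_lt_top

lemma volume_abs_coord_le_inter_ball_le {d : ℕ} (i : Fin d) {c t : ℝ} (hc : 0 ≤ c) (ht : 0 < t) :
    volume ({y : EuclideanSpace ℝ (Fin d) | |y i| ≤ c * ‖y‖ ^ 2} ∩ ball 0 t) ≤
      ENNReal.ofReal (2 ^ d * c * t ^ ((d : ℝ) + 1)) := by
  set b : Fin d → ℝ := fun j => t * if j = i then c * t else 1 with hb
  have hb0 : ∀ j, 0 ≤ 2 * b j := fun j => by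
    simp only [hb]; split_ifs <;> positivity
  have hsub : {y : EuclideanSpace ℝ (Fin d) | |y i| ≤ c * ‖y‖ ^ 2} ∩ ball 0 t ⊆
      (WithLp.ofLp : EuclideanSpace ℝ (Fin d) → (Fin d → ℝ)) ⁻¹'
        (univ.pi fun j => Icc (-b j) (b j)) := by
    rintro y ⟨hy, hyt⟩ j -
    rw [mem_ball_zero_iff] at hyt
    rw [mem_ofPred_eq] at hy
    rw [mem_Icc, ← abs_le]
    simp only [hb]
    split_ifs with hj
    · subst hj
      calc |y j| ≤ c * ‖y‖ ^ 2 := hy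
        _ ≤ c * t ^ 2 := by gcongr
        _ = t * (c * t) := by ring
    · rw [mul_one]
      exact (PiLp.norm_apply_le y j).trans hyt.le
  refine (measure_mono hsub).trans_eq ?_
  rw [(PiLp.volume_preserving_ofLp (Fin d)).measure_preimage
    (MeasurableSet.univ_pi fun j => measurableSet_Icc).nullMeasurableSet, volume_pi_pi]
  simp only [Real.volume_Icc, sub_neg_eq_add, ← two_mul]
  rw [← ENNReal.ofReal_prod_of_nonneg fun j _ => hb0 j]
  congr 1
  simp only [hb, Finset.prod_mul_distrib, Finset.prod_const, Finset.card_univ, Fintype.card_fin,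
    Finset.prod_ite_eq', Finset.mem_univ, if_true]
  rw [Real.rpow_add ht, Real.rpow_natCast, Real.rpow_one]
  ring

lemma chiDiff_of_mem {d : ℕ} {E : Set (EuclideanSpace ℝ (Fin d))} {y : EuclideanSpace ℝ (Fin d)}
    (h : y ∈ E) : chiDiff E y = -1 := by
  simp [chiDiff, h]

lemma chiDiff_of_notMem {d : ℕ} {E : Set (EuclideanSpace ℝ (Fin d))}
    {y : EuclideanSpace ℝ (Fin d)} (h : y ∉ E) : chiDiff E y = 1 := by
  simp [chiDiff, h]

lemma abs_chiDiff {d : ℕ} (E : Set (EuclideanSpace ℝ (Fin d))) (y : EuclideanSpace ℝ (Fin d)) :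
    |chiDiff E y| = 1 := by
  by_cases h : y ∈ E
  · simp [chiDiff_of_mem h]
  · simp [chiDiff_of_notMem h]

lemma measurable_chiDiff {d : ℕ} {E : Set (EuclideanSpace ℝ (Fin d))} (hE : MeasurableSet E) :
    Measurable (chiDiff E) :=
  (measurable_const.indicator hE.compl).sub (measurable_const.indicator hE)

lemma chiDiff_add_chiDiff_neg_eq_zero {d : ℕ} (hd : 0 < d) {E : Set (EuclideanSpace ℝ (Fin d))}
    {δ : ℝ} (hδ : 0 < δ) (hin : ball (-(δ • ed d)) δ ⊆ E) (hout : ball (δ • ed d) δ ⊆ Eᶜ)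
    {y : EuclideanSpace ℝ (Fin d)}
    (hy : (2 * δ)⁻¹ * ‖y‖ ^ 2 < |y (⟨d - 1, by omega⟩ : Fin d)|) :
    chiDiff E y + chiDiff E (-y) = 0 := by
  have key : ∀ z : EuclideanSpace ℝ (Fin d),
      (2 * δ)⁻¹ * ‖z‖ ^ 2 < z (⟨d - 1, by omega⟩ : Fin d) → z ∈ ball (δ • ed d) δ := by
    intro z hz
    have he : ‖ed d‖ = 1 := by simp [ed, hd]
    have hi : inner ℝ z (ed d) = z (⟨d - 1, by omega⟩ : Fin d) := by
      simp [ed, hd, EuclideanSpace.inner_single_right]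
    rw [mem_ball, dist_eq_norm, ← sq_lt_sq₀ (norm_nonneg _) hδ.le, norm_sub_sq_real,
      inner_smul_right, hi, norm_smul, he, Real.norm_of_nonneg hδ.le]
    rw [inv_mul_lt_iff₀ (by positivity)] at hz
    linarith
  have key' : ∀ z ∈ ball (δ • ed d) δ, z ∉ E ∧ -z ∈ E := fun z hz => by
    refine ⟨hout hz, hin ?_⟩
    rwa [mem_ball, dist_neg_neg, ← mem_ball]
  rcases lt_abs.1 hy with h | h
  · obtain ⟨h1, h2⟩ := key' y (key y h)
    simp [chiDiff_of_mem h2, chiDiff_of_notMem h1]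
  · obtain ⟨h1, h2⟩ := key' (-y) (key (-y) (by simpa using h))
    rw [neg_neg] at h2
    simp [chiDiff_of_mem h2, chiDiff_of_notMem h1]

lemma integrableOn_chiDiff_symm_div {d : ℕ} (hd : 0 < d) {E : Set (EuclideanSpace ℝ (Fin d))}
    (hE : MeasurableSet E) {δ : ℝ} (hδ : 0 < δ) (hin : ball (-(δ • ed d)) δ ⊆ E)
    (hout : ball (δ • ed d) δ ⊆ Eᶜ) (R : ℝ) {p : ℝ} (hp : 0 < p) (hpd : p < d + 1) :
    IntegrableOn (fun y => (chiDiff E y + chiDiff E (-y)) / ‖y‖ ^ p) (ball 0 R) := by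
  set i : Fin d := ⟨d - 1, by omega⟩
  set A : Set (EuclideanSpace ℝ (Fin d)) := {y | |y i| ≤ (2 * δ)⁻¹ * ‖y‖ ^ 2}
  have hAm : MeasurableSet A := measurableSet_le (by fun_prop) (by fun_prop)
  have hfin : IsFiniteMeasure (volume.restrict (A ∩ ball 0 R)) :=
    isFiniteMeasure_restrict.2
      ((measure_mono inter_subset_right).trans_lt measure_ball_lt_top).ne
  have hint : IntegrableOn (fun y => ‖y‖ ^ (-p)) (A ∩ ball 0 R) := by
    refine integrable_norm_rpow_neg_of_measure_ball_le _ (C := 2 ^ d * (2 * δ)⁻¹) hp hpd ?_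
    intro t ht
    refine le_trans ?_ (volume_abs_coord_le_inter_ball_le i (by positivity) ht)
    rw [Measure.restrict_apply measurableSet_ball]
    exact measure_mono fun y hy => ⟨hy.2.1, hy.1⟩
  have hint2 : IntegrableOn (A.indicator fun y => 2 * ‖y‖ ^ (-p)) (ball 0 R) := by
    rw [IntegrableOn, integrable_indicator_iff hAm, IntegrableOn,
      Measure.restrict_restrict hAm]
    exact hint.const_mul 2
  have hm : Measurable fun y => (chiDiff E y + chiDiff E (-y)) / ‖y‖ ^ p :=
    ((measurable_chiDiff hE).add ((measurable_chiDiff hE).comp measurable_neg)).div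
      (measurable_norm.pow_const _)
  refine hint2.mono' hm.aestronglyMeasurable (ae_of_all _ fun y => ?_)
  by_cases hy : y ∈ A
  · rw [indicator_of_mem hy, norm_div, Real.norm_of_nonneg (Real.rpow_nonneg (norm_nonneg y) _),
      Real.rpow_neg (norm_nonneg y), div_eq_mul_inv]
    gcongr
    refine (norm_add_le _ _).trans ?_
    rw [Real.norm_eq_abs, Real.norm_eq_abs, abs_chiDiff, abs_chiDiff]
    norm_num
  · rw [indicator_of_notMem hy,
      chiDiff_add_chiDiff_neg_eq_zero hd hδ hin hout (not_le.1 hy), zero_div, norm_zero]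

lemma integrableOn_chiDiff_div_annulus {d : ℕ} {E : Set (EuclideanSpace ℝ (Fin d))}
    (hE : MeasurableSet E) (R : ℝ) {p r : ℝ} (hp : 0 < p) (hr : 0 < r) :
    IntegrableOn (fun y => chiDiff E y / ‖y‖ ^ p) (ball 0 R \ ball 0 r) := by
  refine IntegrableOn.of_bound
    ((measure_mono sdiff_subset).trans_lt measure_ball_lt_top)
    ((measurable_chiDiff hE).div (measurable_norm.pow_const _)).aestronglyMeasurable
    (1 / r ^ p) ?_
  refine ae_restrict_of_forall_mem (measurableSet_ball.diff measurableSet_ball) fun y hy => ?_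
  have hy2 : r ≤ ‖y‖ := by simpa using hy.2
  rw [norm_div, Real.norm_eq_abs, abs_chiDiff,
    Real.norm_of_nonneg (Real.rpow_nonneg (norm_nonneg y) _)]
  gcongr

lemma setIntegral_chiDiff_annulus {d : ℕ} {E : Set (EuclideanSpace ℝ (Fin d))}
    (hE : MeasurableSet E) (R : ℝ) {p r : ℝ} (hp : 0 < p) (hr : 0 < r) :
    ∫ y in ball 0 R \ ball 0 r, chiDiff E y / ‖y‖ ^ p =
      2⁻¹ * ∫ y in ball 0 R \ ball 0 r, (chiDiff E y + chiDiff E (-y)) / ‖y‖ ^ p := by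
  have hS : MeasurableSet (ball (0 : EuclideanSpace ℝ (Fin d)) R \ ball 0 r) :=
    measurableSet_ball.diff measurableSet_ball
  have hind : (fun y => (ball 0 R \ ball 0 r).indicator (fun y => chiDiff E y / ‖y‖ ^ p) (-y)) =
      (ball 0 R \ ball 0 r).indicator fun y => chiDiff E (-y) / ‖y‖ ^ p := by
    ext y
    simp [indicator]
  have hint := integrableOn_chiDiff_div_annulus hE R hp hr
  have hneg : ∫ y in ball 0 R \ ball 0 r, chiDiff E (-y) / ‖y‖ ^ p =
      ∫ y in ball 0 R \ ball 0 r, chiDiff E y / ‖y‖ ^ p := by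
    rw [← integral_indicator hS, ← integral_indicator hS, ← hind, integral_neg_eq_self]
  have hint' : IntegrableOn (fun y => chiDiff E (-y) / ‖y‖ ^ p) (ball 0 R \ ball 0 r) := by
    rw [← integrable_indicator_iff hS, ← hind]
    exact ((integrable_indicator_iff hS).2 hint).comp_neg
  simp only [add_div]
  rw [integral_add hint hint', hneg]
  ring

lemma tendsto_setIntegral_chiDiff_annulus {d : ℕ} (hd : 0 < d)
    {E : Set (EuclideanSpace ℝ (Fin d))} (hE : MeasurableSet E) {δ : ℝ} (hδ : 0 < δ)
    (hin : ball (-(δ • ed d)) δ ⊆ E) (hout : ball (δ • ed d) δ ⊆ Eᶜ) (R : ℝ) {p : ℝ}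
    (hp : 0 < p) (hpd : p < d + 1) :
    Tendsto (fun r : ℝ => ∫ y in ball 0 R \ ball 0 r, chiDiff E y / ‖y‖ ^ p)
      (nhdsWithin 0 (Ioi 0))
      (nhds (2⁻¹ * ∫ y in ball 0 R, (chiDiff E y + chiDiff E (-y)) / ‖y‖ ^ p)) := by
  set G : EuclideanSpace ℝ (Fin d) → ℝ :=
    fun y => (chiDiff E y + chiDiff E (-y)) / ‖y‖ ^ p with hG
  have hGint : IntegrableOn G (ball 0 R) :=
    integrableOn_chiDiff_symm_div hd hE hδ hin hout R hp hpd
  have hlim : Tendsto (fun r : ℝ => ∫ y in ball 0 R, (ball 0 r)ᶜ.indicator G y)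
      (nhdsWithin 0 (Ioi 0)) (nhds (∫ y in ball 0 R, G y)) := by
    refine tendsto_integral_filter_of_dominated_convergence (fun y => ‖G y‖)
      (Eventually.of_forall fun r =>
        hGint.aestronglyMeasurable.indicator measurableSet_ball.compl)
      (Eventually.of_forall fun r => ae_of_all _ fun y => norm_indicator_le_norm_self _ _)
      hGint.norm (ae_of_all _ fun y => ?_)
    refine tendsto_const_nhds.congr' ?_
    rcases eq_or_ne y 0 with rfl | hy
    · refine Eventually.of_forall fun r => ?_
      have h0 : G 0 = 0 := by simp [hG, Real.zero_rpow hp.ne']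
      simp [indicator, h0]
    · filter_upwards [mem_nhdsWithin_of_mem_nhds (Iio_mem_nhds (norm_pos_iff.2 hy))] with r hr
      rw [indicator_of_mem]
      simpa using (le_of_lt hr : r ≤ ‖y‖)
  refine (hlim.const_mul 2⁻¹).congr' ?_
  filter_upwards [self_mem_nhdsWithin] with r hr
  rw [setIntegral_chiDiff_annulus hE R hp hr, setIntegral_indicator measurableSet_ball.compl,
    sdiff_eq]

lemma tendsto_setIntegral_chiDiff_symm {d : ℕ} (hd : 0 < d)
    {E : Set (EuclideanSpace ℝ (Fin d))} (hE : MeasurableSet E) {δ : ℝ} (hδ : 0 < δ)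
    (hin : ball (-(δ • ed d)) δ ⊆ E) (hout : ball (δ • ed d) δ ⊆ Eᶜ) (R : ℝ) :
    Tendsto (fun s : ℝ => ∫ y in ball 0 R, (chiDiff E y + chiDiff E (-y)) / ‖y‖ ^ ((d : ℝ) + s))
      (nhdsWithin 0 (Ioi 0))
      (nhds (∫ y in ball 0 R, (chiDiff E y + chiDiff E (-y)) / ‖y‖ ^ (d : ℝ))) := by
  have hd' : (0 : ℝ) < d := by exact_mod_cast hd
  have hint {p : ℝ} (hp : 0 < p) (hpd : p < d + 1) :=
    integrableOn_chiDiff_symm_div hd hE hδ hin hout R hp hpd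
  have hs : ∀ᶠ s : ℝ in nhdsWithin 0 (Ioi 0), s ∈ Ioo (0 : ℝ) 2⁻¹ :=
    Ioo_mem_nhdsGT (by norm_num)
  refine tendsto_integral_filter_of_dominated_convergence
    (fun y => ‖(chiDiff E y + chiDiff E (-y)) / ‖y‖ ^ (d : ℝ)‖ +
      ‖(chiDiff E y + chiDiff E (-y)) / ‖y‖ ^ ((d : ℝ) + 2⁻¹)‖) ?_ ?_
    ((hint hd' (by linarith)).norm.add (hint (by linarith) (by linarith)).norm)
    (ae_of_all _ fun y => ?_)
  · filter_upwards [hs] with s hs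
    exact (hint (by linarith [hs.1]) (by linarith [hs.2])).aestronglyMeasurable
  · filter_upwards [hs] with s hs
    refine ae_of_all _ fun y => ?_
    rcases eq_or_ne y 0 with rfl | hy
    · simp [Real.zero_rpow (by linarith [hs.1] : (d : ℝ) + s ≠ 0)]
      positivity
    have hy0 : 0 < ‖y‖ := norm_pos_iff.2 hy
    rcases le_total ‖y‖ 1 with h1 | h1
    · refine le_trans ?_ (le_add_of_nonneg_left (norm_nonneg _))
      rw [norm_div, norm_div, Real.norm_of_nonneg (by positivity : 0 ≤ ‖y‖ ^ ((d : ℝ) + s)),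
        Real.norm_of_nonneg (by positivity : 0 ≤ ‖y‖ ^ ((d : ℝ) + 2⁻¹))]
      exact div_le_div_of_nonneg_left (norm_nonneg _) (by positivity)
        (Real.rpow_le_rpow_of_exponent_ge hy0 h1 (by linarith [hs.2]))
    · refine le_trans ?_ (le_add_of_nonneg_right (norm_nonneg _))
      rw [norm_div, norm_div, Real.norm_of_nonneg (by positivity : 0 ≤ ‖y‖ ^ ((d : ℝ) + s)),
        Real.norm_of_nonneg (by positivity : 0 ≤ ‖y‖ ^ (d : ℝ))]
      exact div_le_div_of_nonneg_left (norm_nonneg _) (by positivity)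
        (Real.rpow_le_rpow_of_exponent_le h1 (by linarith [hs.1]))
  · refine Tendsto.mono_left ?_ nhdsWithin_le_nhds
    rcases eq_or_ne y 0 with rfl | hy
    · refine tendsto_const_nhds.congr' ?_
      filter_upwards [Ioi_mem_nhds (neg_lt_zero.2 hd')] with s hs
      have h2 : (d : ℝ) + s ≠ 0 := by linarith [mem_Ioi.1 hs]
      simp [Real.zero_rpow h2, hd.ne']
    · have hy0 : ‖y‖ ≠ 0 := norm_ne_zero_iff.2 hy
      have hc : ContinuousAt (fun s : ℝ => (chiDiff E y + chiDiff E (-y)) / ‖y‖ ^ ((d : ℝ) + s))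
          0 := by
        refine continuousAt_const.div ?_ (by simp [hy0])
        exact continuousAt_const.rpow (by fun_prop) (Or.inl hy0)
      simpa [ContinuousAt] using hc

lemma integrableOn_compl_ball_norm_rpow {d : ℕ} (hd : 0 < d) {R s : ℝ} (hR : 0 < R)
    (hs : 0 < s) :
    IntegrableOn (fun y : EuclideanSpace ℝ (Fin d) => 1 / ‖y‖ ^ ((d : ℝ) + s)) (ball 0 R)ᶜ ∧
    ∫ y in (ball (0 : EuclideanSpace ℝ (Fin d)) R)ᶜ, 1 / ‖y‖ ^ ((d : ℝ) + s) =
      d * unitBallVol d * (R ^ (-s) / s) := by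
  have : Nonempty (Fin d) := ⟨⟨0, hd⟩⟩
  set f : ℝ → ℝ := (Ici R).indicator fun t => 1 / t ^ ((d : ℝ) + s) with hf
  have hfn : (ball (0 : EuclideanSpace ℝ (Fin d)) R)ᶜ.indicator
      (fun y => 1 / ‖y‖ ^ ((d : ℝ) + s)) = fun y => f ‖y‖ := by
    ext y
    simp [hf, indicator]
  have hfr : (fun t : ℝ => t ^ (d - 1) • f t) = (Ici R).indicator fun t => t ^ (-s - 1) := by
    ext t
    by_cases ht : t ∈ Ici R
    · have ht0 : 0 < t := hR.trans_le ht
      simp only [hf, indicator_of_mem ht, smul_eq_mul]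
      rw [one_div, ← Real.rpow_neg ht0.le, ← Real.rpow_natCast, ← Real.rpow_add ht0,
        Nat.cast_sub hd]
      congr 1
      push_cast
      ring
    · simp [hf, indicator_of_notMem ht]
  have hsub : Ioi (0 : ℝ) ∩ Ici R = Ici R :=
    inter_eq_right.2 fun t ht => hR.trans_le ht
  have hs1 : -s - 1 < -1 := by linarith
  constructor
  · rw [← integrable_indicator_iff measurableSet_ball.compl, hfn, integrable_fun_norm_addHaar,
      finrank_euclideanSpace_fin, hfr, IntegrableOn, integrable_indicator_iff measurableSet_Ici,
      IntegrableOn, Measure.restrict_restrict measurableSet_Ici, inter_comm, hsub]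
    exact (integrableOn_Ici_iff_integrableOn_Ioi).2 (integrableOn_Ioi_rpow_of_lt hs1 hR)
  · rw [← integral_indicator measurableSet_ball.compl, hfn, integral_fun_norm_addHaar,
      finrank_euclideanSpace_fin, hfr, setIntegral_indicator measurableSet_Ici, hsub,
      integral_Ici_eq_integral_Ioi, integral_Ioi_rpow_of_lt hs1 hR]
    simp only [nsmul_eq_mul, smul_eq_mul, unitBallVol, Measure.real, sub_add_cancel,
      neg_div_neg_eq, mul_assoc]

lemma tendsto_rpow_neg_sub_one_div {R : ℝ} (hR : 0 < R) :
    Tendsto (fun s : ℝ => R ^ (-s) / s - 1 / s) (nhdsWithin 0 (Ioi 0)) (nhds (-Real.log R)) := by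
  have h : HasDerivAt (fun s : ℝ => R ^ (-s)) (-Real.log R) 0 := by
    simpa using (hasDerivAt_neg (0 : ℝ)).const_rpow hR
  refine h.tendsto_slope_zero_right.congr fun s => ?_
  simp
  ring

/-- second-order behaviour as `s → 0⁺`:
`H^s(0,E) - d ω_d / s → H^0(0,E)`. -/
theorem stmt_8 (d : ℕ) (hd : 0 < d) (E : Set (EuclideanSpace ℝ (Fin d)))
    (hEc : IsCompact E) (h0 : (0 : EuclideanSpace ℝ (Fin d)) ∈ frontier E)
    (δ : ℝ) (hδ : 0 < δ)
    (hin : Metric.ball (-(δ • ed d)) δ ⊆ E)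
    (hout : Metric.ball (δ • ed d) δ ⊆ Eᶜ) :
    ∃ Hs : ℝ → ℝ, (∀ s ∈ Set.Ioo (0:ℝ) 1, HasFracCurv s E 0 (Hs s)) ∧
      Tendsto (fun s => Hs s - (d : ℝ) * unitBallVol d / s)
        (nhdsWithin 0 (Set.Ioi 0)) (nhds (H0 E 0)) := by
  have hd' : (0 : ℝ) < d := by exact_mod_cast hd
  have hE : MeasurableSet E := hEc.measurableSet
  have h0E : (0 : EuclideanSpace ℝ (Fin d)) ∈ E := hEc.isClosed.frontier_subset h0
  set R : ℝ := diam E + 1 with hR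
  have hR0 : 0 < R := by linarith [diam_nonneg (s := E)]
  have hchi : ∀ y ∈ (ball (0 : EuclideanSpace ℝ (Fin d)) R)ᶜ, chiDiff E y = 1 := by
    intro y hy
    refine chiDiff_of_notMem fun hyE => hy ?_
    exact (dist_le_diam_of_mem hEc.isBounded hyE h0E).trans_lt (by linarith)
  set J : ℝ → ℝ := fun p =>
    2⁻¹ * ∫ y in ball 0 R, (chiDiff E y + chiDiff E (-y)) / ‖y‖ ^ p with hJ
  have hlim {p : ℝ} (hp : 0 < p) (hpd : p < d + 1) :=
    tendsto_setIntegral_chiDiff_annulus hd hE hδ hin hout R hp hpd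
  refine ⟨fun s => J (d + s) + d * unitBallVol d * (R ^ (-s) / s), ?_, ?_⟩
  · rintro s ⟨hs0, hs1⟩
    obtain ⟨hti, htv⟩ := integrableOn_compl_ball_norm_rpow hd hR0 hs0
    have hcongr : EqOn (fun y => chiDiff E y / ‖y‖ ^ ((d : ℝ) + s))
        (fun y => 1 / ‖y‖ ^ ((d : ℝ) + s)) (ball 0 R)ᶜ := fun y hy => by
      simp only [hchi y hy]
    refine ((hlim (p := d + s) (by linarith) (by linarith)).add_const
      (d * unitBallVol d * (R ^ (-s) / s))).congr' ?_
    filter_upwards [Ioo_mem_nhdsGT hR0] with r hr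
    have hunion : (ball (0 : EuclideanSpace ℝ (Fin d)) r)ᶜ =
        (ball 0 R \ ball 0 r) ∪ (ball 0 R)ᶜ := by
      ext y
      have := hr.2
      simp only [mem_compl_iff, mem_union, Set.mem_sdiff, mem_ball_zero_iff]
      grind
    simp only [sub_zero]
    rw [hunion, setIntegral_union (disjoint_compl_right.mono_left sdiff_subset)
      measurableSet_ball.compl
      (integrableOn_chiDiff_div_annulus hE R (by linarith) hr.1)
      (hti.congr_fun hcongr.symm measurableSet_ball.compl),
      setIntegral_congr_fun measurableSet_ball.compl hcongr, htv]
  · have hH0 : H0 E 0 = J d + d * unitBallVol d * (-Real.log R) := by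
      have := (hlim hd' (by linarith)).limUnder_eq
      simp only [H0, sub_zero, ← hR, this, hJ]
      ring
    rw [hH0]
    refine (((tendsto_setIntegral_chiDiff_symm hd hE hδ hin hout R).const_mul 2⁻¹).add
      ((tendsto_rpow_neg_sub_one_div hR0).const_mul (d * unitBallVol d))).congr fun s => ?_
    simp only [hJ]
    ring
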